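/- arXiv:1203.6795 — 2 statements merged into one kernel-verified Lean document; each statement's English description precedes it below -/
import Mathlib

section
/- Let X ⊆ 𝟚^ℤ be a nonempty subshift with B_1(X) = 𝟚 that is closed under the cellwise operations ⊓ and ⊔ and under cellwise complementation (x ↦ (¬x_i)_i). Then either X = 𝟚^ℤ, or X = { x ∈ 𝟚^ℤ : σ^n(x) = x } for some n ≥ 1. -/
/-- The shift map on the full shift `ℤ → α`. -/
def shiftMap {α : Type*} (x : ℤ → α) : ℤ → α := fun i => x (i + 1)

/-- `X` is a subshift: shift-invariant (`σ(X) = X`) and closed. -/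
def IsSubshift {α : Type*} (X : Set (ℤ → α)) : Prop :=
  (∀ x ∈ X, shiftMap x ∈ X) ∧ (∀ x ∈ X, ∃ y ∈ X, shiftMap y = x) ∧
    ∀ x : ℤ → α, (∀ n : ℕ, ∃ y ∈ X, ∀ i : ℤ, |i| ≤ (n : ℤ) → y i = x i) → x ∈ X

theorem shiftMap_iterate_apply {α : Type*} (n : ℕ) (x : ℤ → α) (i : ℤ) :
    shiftMap^[n] x i = x (i + n) := by
  induction n generalizing i with
  | zero => simp
  | succ n ih =>
    rw [Function.iterate_succ_apply']
    simp only [shiftMap, ih]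
    congr 1
    push_cast
    ring

/-- A subshift is invariant under translation by every integer. -/
theorem IsSubshift.translate_mem {α : Type*} {X : Set (ℤ → α)} (hX : IsSubshift X)
    {x : ℤ → α} (hx : x ∈ X) (k : ℤ) : (fun i => x (i + k)) ∈ X := by
  induction k using Int.induction_on with
  | zero => simpa using hx
  | succ n ih =>
    convert hX.1 _ ih using 1
    funext i
    simp only [shiftMap]
    congr 1
    ring
  | pred n ih =>
    obtain ⟨y, hy, hyx⟩ := hX.2.1 _ ih
    convert hy using 1
    funext i
    have h := congrFun hyx (i - 1)
    simp only [shiftMap, sub_add_cancel] at h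
    rw [h]
    congr 1
    ring

/-- The group of common periods of the points of `X`. -/
def commonPeriods {α : Type*} (X : Set (ℤ → α)) : AddSubgroup ℤ where
  carrier := {n | ∀ x ∈ X, Function.Periodic x n}
  zero_mem' := fun x _ i => by simp
  add_mem' := fun ha hb x hx => (ha x hx).add_period (hb x hx)
  neg_mem' := fun ha x hx => (ha x hx).neg

theorem IsSubshift.sub_mem_commonPeriods {α : Type*} {X : Set (ℤ → α)} (hX : IsSubshift X)
    {i j : ℤ} (h : ∀ x ∈ X, x i = x j) : j - i ∈ commonPeriods X := by
  intro x hx k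
  have hk := h _ (hX.translate_mem hx (k - i))
  simp only [add_sub_cancel] at hk
  rw [hk]
  congr 1
  ring

section BooleanSubalgebra

variable {ι : Type*} {X : Set (ι → Bool)}

theorem exists_mem_eq_true_eq_false (hcompl : ∀ x ∈ X, (fun i => !(x i)) ∈ X) {i j : ι}
    (h : ¬ ∀ x ∈ X, x i = x j) : ∃ z ∈ X, z i = true ∧ z j = false := by
  push Not at h
  obtain ⟨z, hz, hij⟩ := h
  cases hi : z i
  · exact ⟨_, hcompl z hz, by simp [hi], by simpa [hi] using hij.symm⟩
  · exact ⟨z, hz, hi, by simpa [hi] using hij.symm⟩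

/-- A Boolean algebra of functions realizes, on finite sets, every function that
is constant on the classes of coordinates it does not separate. -/
theorem exists_mem_eqOn_finset (hne : X.Nonempty)
    (hops : ∀ x ∈ X, ∀ y ∈ X, (fun i => x i && y i) ∈ X ∧ (fun i => x i || y i) ∈ X)
    (hcompl : ∀ x ∈ X, (fun i => !(x i)) ∈ X) {x : ι → Bool}
    (hx : ∀ i j, (∀ y ∈ X, y i = y j) → x i = x j) (F : Finset ι) :
    ∃ y ∈ X, ∀ i ∈ F, y i = x i := by
  classical
  obtain ⟨w, hw⟩ := hne
  have hbot : (fun _ => false) ∈ X := by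
    simpa using (hops w hw _ (hcompl w hw)).1
  have htop : (fun _ => true) ∈ X := by
    simpa using (hops w hw _ (hcompl w hw)).2
  have hpoint (i : ι) (hi : x i = true) (G : Finset ι) :
      ∃ y ∈ X, y i = true ∧ ∀ j ∈ G, x j = false → y j = false := by
    induction G using Finset.induction_on with
    | empty => exact ⟨_, htop, rfl, by simp⟩
    | insert a G _ ih =>
      obtain ⟨y, hy, hyi, hyG⟩ := ih
      cases ha : x a
      · obtain ⟨z, hz, hzi, hza⟩ := exists_mem_eq_true_eq_false hcompl
          (fun h => by simpa [hi, ha] using hx i a h)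
        refine ⟨_, (hops y hy z hz).1, by simp [hyi, hzi], fun j hj hxj => ?_⟩
        rcases Finset.mem_insert.1 hj with rfl | hj
        · simp [hza]
        · simp [hyG j hj hxj]
      · refine ⟨y, hy, hyi, fun j hj hxj => ?_⟩
        rcases Finset.mem_insert.1 hj with rfl | hj
        · simp [ha] at hxj
        · exact hyG j hj hxj
  have hset (G : Finset ι) : ∃ y ∈ X, (∀ i ∈ G, x i = true → y i = true) ∧
      ∀ j ∈ F, x j = false → y j = false := by
    induction G using Finset.induction_on with
    | empty => exact ⟨_, hbot, by simp, by simp⟩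
    | insert a G _ ih =>
      obtain ⟨y, hy, hyG, hyF⟩ := ih
      cases ha : x a
      · refine ⟨y, hy, fun i hi hxi => ?_, hyF⟩
        rcases Finset.mem_insert.1 hi with rfl | hi
        · simp [ha] at hxi
        · exact hyG i hi hxi
      · obtain ⟨z, hz, hza, hzF⟩ := hpoint a ha F
        refine ⟨_, (hops y hy z hz).2, fun i hi hxi => ?_, fun j hj hxj => ?_⟩
        · rcases Finset.mem_insert.1 hi with rfl | hi
          · simp [hza]
          · simp [hyG i hi hxi]
        · simp [hyF j hj hxj, hzF j hj hxj]
  obtain ⟨y, hy, h1, h0⟩ := hset F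
  refine ⟨y, hy, fun i hi => ?_⟩
  cases h : x i
  · exact h0 i hi h
  · exact h1 i hi h

end BooleanSubalgebra

/-- A subshift that is a Boolean algebra is determined by its common periods. -/
theorem IsSubshift.mem_iff_forall_periodic {X : Set (ℤ → Bool)} (hX : IsSubshift X)
    (hne : X.Nonempty)
    (hops : ∀ x ∈ X, ∀ y ∈ X, (fun i => x i && y i) ∈ X ∧ (fun i => x i || y i) ∈ X)
    (hcompl : ∀ x ∈ X, (fun i => !(x i)) ∈ X) (x : ℤ → Bool) :
    x ∈ X ↔ ∀ n ∈ commonPeriods X, Function.Periodic x n := by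
  refine ⟨fun hx n hn => hn x hx, fun h => hX.2.2 x fun n => ?_⟩
  have hsep (i j : ℤ) (hij : ∀ y ∈ X, y i = y j) : x i = x j := by
    simpa using (h _ (hX.sub_mem_commonPeriods hij) i).symm
  obtain ⟨y, hy, hyx⟩ :=
    exists_mem_eqOn_finset hne hops hcompl hsep (Finset.Icc (-(n : ℤ)) n)
  exact ⟨y, hy, fun i hi => hyx i (Finset.mem_Icc.2 (abs_le.1 hi))⟩

/-- A nonempty binary subshift with both symbols occurring which is closed under the
cellwise lattice operations and cellwise complementation is either the full shift or
the set of `n`-periodic points for some `n ≥ 1`. -/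
theorem stmt5 (X : Set (ℤ → Bool)) (hX : IsSubshift X) (hne : X.Nonempty)
    (hB1 : ∀ a : Bool, ∃ x ∈ X, x 0 = a)
    (hops : ∀ x ∈ X, ∀ y ∈ X, (fun i => x i && y i) ∈ X ∧ (fun i => x i || y i) ∈ X)
    (hcompl : ∀ x ∈ X, (fun i => !(x i)) ∈ X) :
    X = Set.univ ∨ ∃ n : ℕ, 0 < n ∧ X = {x : ℤ → Bool | shiftMap^[n] x = x} := by
  have hmem := hX.mem_iff_forall_periodic hne hops hcompl
  obtain ⟨a, ha⟩ := Int.subgroup_cyclic (commonPeriods X)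
  rw [← AddSubgroup.zmultiples_eq_closure] at ha
  rcases eq_or_ne a 0 with rfl | ha0
  · left
    refine Set.eq_univ_of_forall fun x => (hmem x).2 fun n hn => ?_
    rw [ha, AddSubgroup.zmultiples_zero_eq_bot, AddSubgroup.mem_bot] at hn
    subst hn
    exact fun i => by simp
  · refine Or.inr ⟨a.natAbs, Int.natAbs_pos.2 ha0, Set.ext fun x => ?_⟩
    have hper : shiftMap^[a.natAbs] x = x ↔ Function.Periodic x (a.natAbs : ℤ) := by
      simp only [funext_iff, shiftMap_iterate_apply, Function.Periodic]
    rw [Set.mem_ofPred_eq, hper, hmem]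
    refine ⟨fun h => h _ ?_, fun h n hn => ?_⟩
    · rw [ha, Int.mem_zmultiples_iff]
      exact Int.dvd_natAbs.2 dvd_rfl
    · rw [ha, Int.mem_zmultiples_iff, ← Int.natAbs_dvd] at hn
      obtain ⟨k, rfl⟩ := hn
      rw [mul_comm]
      exact h.int_mul k
end

section
/- Let S be a finite type and X ⊆ S^ℤ a subshift equipped with operations ⊓, ⊔ : X × X → X, each a block map, making X a distributive lattice. Then there exist a finite lattice S', a subshift Y ⊆ S'^ℤ closed under the cellwise operations of S', and an algebraic conjugacy φ : X → Y. -/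
/-- A map `F` out of a subshift `X` has radius at most `r`. -/
def HasRadius1 {α β : Type*} (X : Set (ℤ → α)) (F : (ℤ → α) → ℤ → β) (r : ℕ) : Prop :=
  ∀ x ∈ X, ∀ y ∈ X, ∀ i : ℤ, (∀ j : ℤ, |j - i| ≤ (r : ℤ) → x j = y j) → F x i = F y i

/-- A binary operation on subshifts has radius at most `r`. -/
def HasRadius2 {α β γ : Type*} (X : Set (ℤ → α)) (Y : Set (ℤ → β))
    (F : (ℤ → α) → (ℤ → β) → ℤ → γ) (r : ℕ) : Prop :=
  ∀ x ∈ X, ∀ x' ∈ X, ∀ y ∈ Y, ∀ y' ∈ Y, ∀ i : ℤ,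
    (∀ j : ℤ, |j - i| ≤ (r : ℤ) → x j = x' j ∧ y j = y' j) → F x y i = F x' y' i

/-- `X` is a lattice subshift with meet `m` and join `j`. -/
structure IsLatticeSubshift {S : Type*} (X : Set (ℤ → S))
    (m j : (ℤ → S) → (ℤ → S) → (ℤ → S)) : Prop where
  subshift : IsSubshift X
  meet_mem : ∀ x ∈ X, ∀ y ∈ X, m x y ∈ X
  join_mem : ∀ x ∈ X, ∀ y ∈ X, j x y ∈ X
  meet_comm : ∀ x ∈ X, ∀ y ∈ X, m x y = m y x
  join_comm : ∀ x ∈ X, ∀ y ∈ X, j x y = j y x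
  meet_assoc : ∀ x ∈ X, ∀ y ∈ X, ∀ z ∈ X, m (m x y) z = m x (m y z)
  join_assoc : ∀ x ∈ X, ∀ y ∈ X, ∀ z ∈ X, j (j x y) z = j x (j y z)
  absorb_meet : ∀ x ∈ X, ∀ y ∈ X, m x (j x y) = x
  absorb_join : ∀ x ∈ X, ∀ y ∈ X, j x (m x y) = x
  meet_radius : ∃ r : ℕ, HasRadius2 X X m r
  join_radius : ∃ r : ℕ, HasRadius2 X X j r
  meet_shift : ∀ x ∈ X, ∀ y ∈ X, shiftMap (m x y) = m (shiftMap x) (shiftMap y)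
  join_shift : ∀ x ∈ X, ∀ y ∈ X, shiftMap (j x y) = j (shiftMap x) (shiftMap y)

/-- Conjugacy data to a cellwise lattice subshift `Y` over a finite lattice `S'`. -/
def ConjugacyData {S : Type*} (X : Set (ℤ → S)) (m j : (ℤ → S) → (ℤ → S) → (ℤ → S))
    {S' : Type} [Lattice S'] (Y : Set (ℤ → S')) : Prop :=
  IsSubshift Y ∧
  (∀ y ∈ Y, ∀ z ∈ Y, (fun i => y i ⊓ z i) ∈ Y ∧ (fun i => y i ⊔ z i) ∈ Y) ∧
  ∃ (φ : (ℤ → S) → (ℤ → S')) (ψ : (ℤ → S') → (ℤ → S)),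
    Set.BijOn φ X Y ∧ (∀ x ∈ X, ψ (φ x) = x) ∧
    (∃ r : ℕ, HasRadius1 X φ r) ∧ (∃ r : ℕ, HasRadius1 Y ψ r) ∧
    (∀ x ∈ X, φ (shiftMap x) = shiftMap (φ x)) ∧
    (∀ x ∈ X, ∀ y ∈ X, φ (m x y) = fun i => φ x i ⊓ φ y i) ∧
    (∀ x ∈ X, ∀ y ∈ X, φ (j x y) = fun i => φ x i ⊔ φ y i)

/-- `(X, m, j)` is, up to algebraic conjugacy, a cellwise lattice subshift. -/
def AlgConjToCellwise {S : Type*} (X : Set (ℤ → S))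
    (m j : (ℤ → S) → (ℤ → S) → (ℤ → S)) : Prop :=
  ∃ (S' : Type) (_ : Fintype S') (iL : Lattice S') (Y : Set (ℤ → S')),
    @ConjugacyData S X m j S' iL Y

/-- A lattice congruence with finitely many classes is the kernel of a surjective homomorphism
onto a finite lattice in `Type`. -/
theorem exists_finite_lattice_quotient {A : Type*} [Lattice A] (s : Setoid A)
    [Finite (Quotient s)]
    (hinf : ∀ x y c : A, s x y → s (x ⊓ c) (y ⊓ c))
    (hsup : ∀ x y c : A, s x y → s (x ⊔ c) (y ⊔ c)) :
    ∃ (L : Type) (_ : Fintype L) (_ : Lattice L) (f : LatticeHom A L),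
      Function.Surjective f ∧ ∀ x y, f x = f y ↔ s x y := by
  obtain ⟨L, ⟨hfin⟩, ⟨e⟩⟩ : ∃ L : Type, Nonempty (Fintype L) ∧ Nonempty (Quotient s ≃ L) :=
    ⟨Fin (Nat.card (Quotient s)), ⟨inferInstance⟩, ⟨Finite.equivFin _⟩⟩
  let f : A → L := fun x => e (Quotient.mk s x)
  have hf : Function.Surjective f := e.surjective.comp Quotient.mk_surjective
  have hrel : ∀ x y, f x = f y ↔ s x y := fun x y => by
    simp only [f, e.apply_eq_iff_eq]
    exact Quotient.eq
  let g := Function.surjInv hf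
  have hg : ∀ a, f (g a) = a := Function.surjInv_eq hf
  have hgf : ∀ x, s (g (f x)) x := fun x => (hrel _ _).1 (hg _)
  let iInf : Min L := ⟨fun a b => f (g a ⊓ g b)⟩
  let iSup : Max L := ⟨fun a b => f (g a ⊔ g b)⟩
  have finf : ∀ x y, f (x ⊓ y) = f x ⊓ f y := fun x y => by
    refine ((hrel _ _).2 (s.trans (hinf _ _ (g (f y)) (hgf x)) ?_)).symm
    rw [inf_comm, inf_comm x]
    exact hinf _ _ _ (hgf y)
  have fsup : ∀ x y, f (x ⊔ y) = f x ⊔ f y := fun x y => by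
    refine ((hrel _ _).2 (s.trans (hsup _ _ (g (f y)) (hgf x)) ?_)).symm
    rw [sup_comm, sup_comm x]
    exact hsup _ _ _ (hgf y)
  let iL : Lattice L := Lattice.mk'
    (hf.forall₂.2 fun x y => by rw [← fsup, ← fsup, sup_comm])
    (hf.forall₃.2 fun x y z => by simp only [← fsup, sup_assoc])
    (hf.forall₂.2 fun x y => by rw [← finf, ← finf, inf_comm])
    (hf.forall₃.2 fun x y z => by simp only [← finf, inf_assoc])
    (hf.forall₂.2 fun x y => by rw [← finf, ← fsup, sup_inf_self])
    (hf.forall₂.2 fun x y => by rw [← fsup, ← finf, inf_sup_self])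
  exact ⟨L, hfin, iL, ⟨⟨f, fsup⟩, finf⟩, hf, hrel⟩

/-- In a distributive lattice, the largest congruence contained in the kernel of `p`. -/
def kernelCongruence {A T : Type*} [Lattice A] (p : A → T) : Setoid A where
  r x y := ∀ a b, p ((x ⊓ a) ⊔ b) = p ((y ⊓ a) ⊔ b)
  iseqv := ⟨fun _ _ _ => rfl, fun h a b => (h a b).symm, fun h k a b => (h a b).trans (k a b)⟩

theorem kernelCongruence_le_ker {A T : Type*} [Lattice A] {p : A → T} {x y : A}
    (h : kernelCongruence p x y) : p x = p y := by
  have h' : p (x ⊓ (x ⊔ y) ⊔ x ⊓ y) = p (y ⊓ (x ⊔ y) ⊔ x ⊓ y) := h (x ⊔ y) (x ⊓ y)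
  rwa [inf_sup_self, sup_inf_self, sup_comm x y, inf_sup_self, inf_comm x y, sup_inf_self] at h'

theorem kernelCongruence_inf {A T : Type*} [Lattice A] {p : A → T} {x y : A}
    (h : kernelCongruence p x y) (c : A) : kernelCongruence p (x ⊓ c) (y ⊓ c) := fun a b => by
  rw [inf_assoc, inf_assoc]
  exact h _ _

theorem kernelCongruence_sup {A T : Type*} [Lattice A] {p : A → T} {x y : A}
    (hd : ∀ x y z : A, x ⊓ (y ⊔ z) = (x ⊓ y) ⊔ (x ⊓ z))
    (h : kernelCongruence p x y) (c : A) : kernelCongruence p (x ⊔ c) (y ⊔ c) := fun a b => by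
  simp only [inf_comm _ a, hd, sup_assoc]
  simp only [inf_comm a]
  exact h _ _

/-- The `i`-th power of the shift map. -/
def shiftBy {α : Type*} (i : ℤ) (x : ℤ → α) : ℤ → α := fun k => x (k + i)

theorem shiftMap_shiftBy {α : Type*} (i : ℤ) (x : ℤ → α) :
    shiftMap (shiftBy i x) = shiftBy (i + 1) x := by
  funext k
  simp only [shiftMap, shiftBy]
  congr 1
  ring

theorem shiftBy_shiftMap {α : Type*} (i : ℤ) (x : ℤ → α) :
    shiftBy i (shiftMap x) = shiftBy (i + 1) x := by
  funext k
  simp only [shiftMap, shiftBy]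
  congr 1
  ring

theorem shiftMap_injective {α : Type*} : Function.Injective (shiftMap (α := α)) := fun x y h => by
  funext k
  have := congrFun h (k - 1)
  simpa [shiftMap] using this

theorem shiftBy_zero {α : Type*} (x : ℤ → α) : shiftBy 0 x = x := by
  funext k
  simp [shiftBy]

theorem IsSubshift.shiftBy_mem {α : Type*} {X : Set (ℤ → α)} (h : IsSubshift X) {x : ℤ → α}
    (hx : x ∈ X) (i : ℤ) : shiftBy i x ∈ X := by
  induction i using Int.induction_on with
  | zero => rwa [shiftBy_zero]
  | succ i ih => rw [← shiftMap_shiftBy]; exact h.1 _ ih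
  | pred i ih =>
    obtain ⟨y, hy, hyx⟩ := h.2.1 _ ih
    have : y = shiftBy (-i - 1) x := shiftMap_injective (by
      rw [hyx, shiftMap_shiftBy, sub_add_cancel])
    rwa [← this]

theorem shiftBy_binop {α : Type*} {X : Set (ℤ → α)} (h : IsSubshift X)
    {m : (ℤ → α) → (ℤ → α) → (ℤ → α)}
    (hm : ∀ x ∈ X, ∀ y ∈ X, shiftMap (m x y) = m (shiftMap x) (shiftMap y))
    {x y : ℤ → α} (hx : x ∈ X) (hy : y ∈ X) (i : ℤ) :
    shiftBy i (m x y) = m (shiftBy i x) (shiftBy i y) := by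
  induction i using Int.induction_on with
  | zero => simp only [shiftBy_zero]
  | succ i ih =>
    rw [← shiftMap_shiftBy, ih, hm _ (h.shiftBy_mem hx _) _ (h.shiftBy_mem hy _),
      shiftMap_shiftBy, shiftMap_shiftBy]
  | pred i ih =>
    apply shiftMap_injective
    rw [hm _ (h.shiftBy_mem hx _) _ (h.shiftBy_mem hy _)]
    simp only [shiftMap_shiftBy, sub_add_cancel, ih]

/-- The lattice carried by a lattice subshift. -/
abbrev IsLatticeSubshift.toLattice {S : Type*} {X : Set (ℤ → S)}
    {m j : (ℤ → S) → (ℤ → S) → (ℤ → S)} (hL : IsLatticeSubshift X m j) : Lattice X :=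
  let _ : Max X := ⟨fun x y => ⟨j x y, hL.join_mem x x.2 y y.2⟩⟩
  let _ : Min X := ⟨fun x y => ⟨m x y, hL.meet_mem x x.2 y y.2⟩⟩
  Lattice.mk'
    (fun x y => Subtype.ext (hL.join_comm x x.2 y y.2))
    (fun x y z => Subtype.ext (hL.join_assoc x x.2 y y.2 z z.2))
    (fun x y => Subtype.ext (hL.meet_comm x x.2 y y.2))
    (fun x y z => Subtype.ext (hL.meet_assoc x x.2 y y.2 z z.2))
    (fun x y => Subtype.ext (hL.absorb_join x x.2 y y.2))
    (fun x y => Subtype.ext (hL.absorb_meet x x.2 y y.2))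

/-- The empty subshift is conjugate to a cellwise lattice subshift. -/
theorem algConjToCellwise_empty {S : Type*} (m j : (ℤ → S) → (ℤ → S) → (ℤ → S)) :
    AlgConjToCellwise (∅ : Set (ℤ → S)) m j := by
  have key : ∀ (L : Type) [Fintype L] [Lattice L] (_ : (ℤ → S) → (ℤ → L))
      (_ : (ℤ → L) → (ℤ → S)), AlgConjToCellwise (∅ : Set (ℤ → S)) m j := by
    intro L _ iL φ ψ
    refine ⟨L, inferInstance, iL, ∅, ⟨by simp, by simp, ?_⟩, by simp, φ, ψ, ?_⟩
    · intro x h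
      simpa using h 0
    · simp [HasRadius1]
  rcases isEmpty_or_nonempty S with hS | ⟨⟨a⟩⟩
  · exact key (Fin 0) (fun x => isEmptyElim (x 0)) (fun x => isEmptyElim (x 0))
  · exact key Unit (fun _ _ => ()) (fun _ _ => a)

/-- A local homomorphism to a finite lattice which determines the central symbol induces an
algebraic conjugacy. -/
theorem IsLatticeSubshift.algConjToCellwise_of_hom {S : Type*} {X : Set (ℤ → S)}
    {m j : (ℤ → S) → (ℤ → S) → (ℤ → S)} (hL : IsLatticeSubshift X m j) (hX : X.Nonempty)
    {L : Type} [Fintype L] [iL : Lattice L] (f : X → L)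
    (finf : ∀ x y : X, f ⟨m x y, hL.meet_mem x x.2 y y.2⟩ = f x ⊓ f y)
    (fsup : ∀ x y : X, f ⟨j x y, hL.join_mem x x.2 y y.2⟩ = f x ⊔ f y)
    (hf : Function.Surjective f)
    (hsep : ∀ x y : X, f x = f y → x.1 0 = y.1 0) {R : ℕ}
    (hR : ∀ x y : X, (∀ k : ℤ, |k| ≤ (R : ℤ) → x.1 k = y.1 k) → f x = f y) :
    AlgConjToCellwise X m j := by
  classical
  have hS := hL.subshift
  obtain ⟨x₀, hx₀⟩ := hX
  let φ : (ℤ → S) → (ℤ → L) := fun x i =>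
    if h : x ∈ X then f ⟨shiftBy i x, hS.shiftBy_mem h i⟩ else f ⟨x₀, hx₀⟩
  let ψ : (ℤ → L) → (ℤ → S) := fun y i => (Function.surjInv hf (y i)).1 0
  have hφ : ∀ {x} (h : x ∈ X) i, φ x i = f ⟨shiftBy i x, hS.shiftBy_mem h i⟩ :=
    fun h i => dif_pos h
  have hcenter : ∀ x ∈ X, ∀ y ∈ X, ∀ i, φ x i = φ y i → x i = y i := by
    intro x hx y hy i h
    rw [hφ hx, hφ hy] at h
    simpa [shiftBy] using hsep _ _ h
  have hψφ : ∀ x ∈ X, ψ (φ x) = x := by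
    intro x hx
    funext i
    have := hsep _ _ ((Function.surjInv_eq hf (φ x i)).trans (hφ hx i))
    simpa [shiftBy] using this
  have hφr : HasRadius1 X φ R := by
    intro x hx y hy i h
    rw [hφ hx, hφ hy]
    refine hR _ _ fun k hk => h (k + i) ?_
    simpa using hk
  have hshift : ∀ x ∈ X, φ (shiftMap x) = shiftMap (φ x) := by
    intro x hx
    funext i
    simp only [shiftMap, hφ (hS.1 x hx), hφ hx]
    congr 2
    exact shiftBy_shiftMap i x
  have hmeet : ∀ x ∈ X, ∀ y ∈ X, φ (m x y) = fun i => φ x i ⊓ φ y i := by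
    intro x hx y hy
    funext i
    rw [hφ (hL.meet_mem x hx y hy), hφ hx, hφ hy, ← finf]
    congr 2
    exact shiftBy_binop hS hL.meet_shift hx hy i
  have hjoin : ∀ x ∈ X, ∀ y ∈ X, φ (j x y) = fun i => φ x i ⊔ φ y i := by
    intro x hx y hy
    funext i
    rw [hφ (hL.join_mem x hx y hy), hφ hx, hφ hy, ← fsup]
    congr 2
    exact shiftBy_binop hS hL.join_shift hx hy i
  refine ⟨L, inferInstance, iL, φ '' X, ⟨?_, ?_, ?_⟩, ?_, φ, ψ, ?_, hψφ, ⟨R, hφr⟩, ⟨0, ?_⟩,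
    hshift, hmeet, hjoin⟩
  · rintro _ ⟨x, hx, rfl⟩
    exact ⟨_, hS.1 x hx, hshift x hx⟩
  · rintro _ ⟨x, hx, rfl⟩
    obtain ⟨y, hy, rfl⟩ := hS.2.1 x hx
    exact ⟨_, ⟨y, hy, rfl⟩, (hshift y hy).symm⟩
  · intro y h
    have h' : ∀ n : ℕ, ∃ x ∈ X, ∀ i : ℤ, |i| ≤ (n : ℤ) → φ x i = y i := fun n => by
      obtain ⟨_, ⟨x, hx, rfl⟩, hxy⟩ := h n
      exact ⟨x, hx, hxy⟩
    choose u huX hu using h'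
    let x : ℤ → S := fun i => u i.natAbs i
    have hux : ∀ (n : ℕ) (i : ℤ), |i| ≤ (n : ℤ) → u n i = x i := fun n i hi =>
      hcenter _ (huX _) _ (huX _) i
        ((hu n i hi).trans (hu i.natAbs i (Int.abs_eq_natAbs i).le).symm)
    have hx : x ∈ X := hS.2.2 x fun n => ⟨u n, huX n, hux n⟩
    refine ⟨x, hx, funext fun i => ?_⟩
    rw [← hu (i.natAbs + R) i (abs_le.2 (by omega))]
    exact hφr _ hx _ (huX _) i fun k hk => (hux _ k (by rw [abs_le] at hk ⊢; omega)).symm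
  · rintro _ ⟨x, hx, rfl⟩ _ ⟨y, hy, rfl⟩
    exact ⟨⟨_, hL.meet_mem x hx y hy, hmeet x hx y hy⟩, ⟨_, hL.join_mem x hx y hy, hjoin x hx y hy⟩⟩
  · refine ⟨Set.mapsTo_image φ X, fun x hx y hy h => ?_, Set.surjOn_image φ X⟩
    rw [← hψφ x hx, h, hψφ y hy]
  · intro y _ z _ i h
    simp only [ψ, h i (by simp)]

/-- Theorem: every distributive lattice subshift is, up to algebraic conjugacy,
a cellwise lattice subshift. -/
theorem stmt10 {S : Type*} [Fintype S]
    (X : Set (ℤ → S)) (m j : (ℤ → S) → (ℤ → S) → (ℤ → S))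
    (hL : IsLatticeSubshift X m j)
    (hdistrib : ∀ x ∈ X, ∀ y ∈ X, ∀ z ∈ X, m x (j y z) = j (m x y) (m x z)) :
    AlgConjToCellwise X m j := by
  rcases X.eq_empty_or_nonempty with rfl | hX
  · exact algConjToCellwise_empty m j
  let _ : Lattice X := hL.toLattice
  obtain ⟨r, hr⟩ := hL.meet_radius
  obtain ⟨t, ht⟩ := hL.join_radius
  let s : Setoid X := kernelCongruence fun x : X => x.1 0
  have hlocal : ∀ x y : X, (∀ k : ℤ, |k| ≤ ((t + r : ℕ) : ℤ) → x.1 k = y.1 k) → s x y := by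
    intro x y h a b
    refine ht _ (x ⊓ a).2 _ (y ⊓ a).2 _ b.2 _ b.2 0 fun k hk => ⟨?_, rfl⟩
    exact hr _ x.2 _ y.2 _ a.2 _ a.2 k fun l hl => ⟨h l (by rw [abs_le] at hk hl ⊢; omega), rfl⟩
  have : Finite (Quotient s) := by
    refine Finite.of_injective
      (fun q (k : Set.Icc (-((t + r : ℕ) : ℤ)) (t + r : ℕ)) => q.out.1 k.1) fun p q h => ?_
    rw [← p.out_eq, ← q.out_eq]
    exact Quotient.sound (hlocal _ _ fun k hk => congrFun h ⟨k, abs_le.1 hk⟩)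
  obtain ⟨L, hfin, iL, f, hf, hrel⟩ := exists_finite_lattice_quotient s
    (fun x y c h => kernelCongruence_inf h c)
    (fun x y c h => kernelCongruence_sup
      (fun x y z => Subtype.ext (hdistrib x x.2 y y.2 z z.2)) h c)
  exact hL.algConjToCellwise_of_hom hX f (fun x y => map_inf f x y) (fun x y => map_sup f x y) hf
    (fun x y h => kernelCongruence_le_ker ((hrel x y).1 h))
    (fun x y h => (hrel x y).2 (hlocal x y h))
end
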